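/- Let m, b, c be positive integers with m > 2. Let q be a prime such that either q^{2c} exactly divides m−1 or q does not divide m−1, and let p be an odd prime such that p divides q^{2b+1} + 1. If p does not divide (m−2)·k, then there does not exist a (q^{2b+1}+1, m, k, λ)-SEDF in any finite abelian group. -/

import Mathlib

/-- A `(v,m,k,λ)`-strong external difference family in a finite abelian group `G`. -/
def IsSEDF {G : Type*} [CommGroup G] [Fintype G] [DecidableEq G]
    {m : ℕ} (D : Fin m → Finset G) (k lam : ℕ) : Prop :=
  0 < m ∧ 0 < k ∧ 0 < lam ∧
  (∀ i, (D i).card = k) ∧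
  (∀ i j, i ≠ j → Disjoint (D i) (D j)) ∧
  ∀ j : Fin m, ∀ g : G,
    (∑ l ∈ Finset.univ.filter (fun l => l ≠ j),
      (((D l) ×ˢ (D j)).filter (fun x => x.1 * x.2⁻¹ = g)).card)
    = if g = 1 then 0 else lam

open Polynomial ComplexConjugate

lemma Polynomial.exists_pow_eq_expand_add (q : ℕ) [Fact q.Prime] (e : ℕ) (f : ℤ[X]) :
    ∃ g : ℤ[X], f ^ q ^ e = expand ℤ (q ^ e) f + C (q : ℤ) * g := by
  have hz : ∀ f : (ZMod q)[X], expand (ZMod q) (q ^ e) f = f ^ q ^ e := by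
    intro f
    induction e with
    | zero => simp
    | succ e ih => rw [pow_succ', expand_mul, ih, map_pow, ZMod.expand_card, ← pow_mul]
  have hd : C (q : ℤ) ∣ f ^ q ^ e - expand ℤ (q ^ e) f := by
    rw [C_dvd_iff_dvd_coeff]
    intro i
    rw [← ZMod.intCast_zmod_eq_zero_iff_dvd]
    have h0 : (f ^ q ^ e - expand ℤ (q ^ e) f).map (Int.castRingHom (ZMod q)) = 0 := by
      rw [Polynomial.map_sub, Polynomial.map_pow, map_expand, hz, sub_self]
    simpa only [coeff_map, eq_intCast, coeff_zero] using congrArg (fun P => P.coeff i) h0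
  obtain ⟨g, hg⟩ := hd
  exact ⟨g, by rw [← hg]; ring⟩

/-- If `p` divides `q ^ e + 1`, then `q` is self-conjugate modulo `p`: whenever `q` divides
`x * conj x` for `x = f(ζ)` with `ζ ^ p = 1`, it divides `x`. -/
lemma exists_aeval_eq_mul_of_dvd_norm {q p e n : ℕ} [Fact q.Prime] (he : e ≠ 0)
    (hdvd : p ∣ q ^ e + 1) {ζ : ℂ} (hζ : ζ ^ p = 1) (hconj : conj ζ * ζ = 1) (f : ℤ[X])
    (hf : aeval ζ f * conj (aeval ζ f) = n) (hqn : q ∣ n) :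
    ∃ g : ℤ[X], aeval ζ f = q * aeval ζ g := by
  have hQ1 : ζ ^ (q ^ e + 1) = 1 := by
    obtain ⟨d, hd⟩ := hdvd
    rw [hd, pow_mul, hζ, one_pow]
  have hQ : ζ ^ q ^ e = conj ζ := by
    have h0 : ζ ≠ 0 := right_ne_zero_of_mul_eq_one hconj
    apply mul_right_cancel₀ h0
    rw [← pow_succ, hQ1, hconj]
  have hQQ : ζ ^ q ^ (e + e) = ζ := by
    rw [pow_add, pow_mul, hQ, ← map_pow, hQ, Complex.conj_conj]
  have hc : aeval (conj ζ) f = conj (aeval ζ f) := by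
    rw [aeval_def, aeval_def, hom_eval₂]
    congr 1
    exact RingHom.ext_int _ _
  obtain ⟨u, hu⟩ := exists_pow_eq_expand_add q e f
  obtain ⟨w, hw⟩ := exists_pow_eq_expand_add q (e + e) f
  have hu' : aeval ζ f ^ q ^ e = conj (aeval ζ f) + q * aeval ζ u := by
    have := congrArg (aeval ζ) hu
    simpa [expand_aeval, hQ, hc] using this
  have hw' : aeval ζ f ^ q ^ (e + e) = aeval ζ f + q * aeval ζ w := by
    have := congrArg (aeval ζ) hw
    simpa [expand_aeval, hQQ] using this
  obtain ⟨d, rfl⟩ := hqn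
  have hq2 : 2 ≤ q ^ e :=
    (Fact.out : q.Prime).two_le.trans (Nat.le_self_pow he q)
  obtain ⟨a, ha⟩ : ∃ a, q ^ (e + e) = q ^ e + 1 + a := by
    refine Nat.exists_eq_add_of_le ?_
    rw [pow_add]
    nlinarith
  rw [ha, pow_add, pow_succ, hu'] at hw'
  refine ⟨(C (d : ℤ) + f * u) * f ^ a - w, ?_⟩
  simp only [map_sub, map_mul, map_add, map_pow, aeval_C]
  push_cast at hf
  simp only [eq_intCast, Int.cast_natCast]
  linear_combination (-1 : ℂ) * hw' + (aeval ζ f) ^ a * hf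

lemma even_padicValNat_of_norm {q p e : ℕ} [Fact q.Prime] (he : e ≠ 0)
    (hdvd : p ∣ q ^ e + 1) {ζ : ℂ} (hζ : ζ ^ p = 1) (hp : p ≠ 0) (n : ℕ) (hn : n ≠ 0) :
    ∀ f : ℤ[X], aeval ζ f * conj (aeval ζ f) = n → Even (padicValNat q n) := by
  have hconj : conj ζ * ζ = 1 := by
    rw [mul_comm, Complex.mul_conj, Complex.normSq_eq_norm_sq,
      Complex.norm_eq_one_of_pow_eq_one hζ hp]
    simp
  induction n using Nat.strong_induction_on with
  | _ n ih =>
    intro f hf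
    by_cases hqn : q ∣ n
    swap
    · simp [padicValNat.eq_zero_of_not_dvd hqn]
    have hq : q.Prime := Fact.out
    have hq0 : (q : ℂ) ≠ 0 := by exact_mod_cast hq.ne_zero
    obtain ⟨g, hg⟩ := exists_aeval_eq_mul_of_dvd_norm he hdvd hζ hconj f hf hqn
    have hζi : IsIntegral ℤ ζ := IsIntegral.of_pow (Nat.pos_of_ne_zero hp) (hζ ▸ isIntegral_one)
    have hgi : IsIntegral ℤ (aeval ζ g) :=
      IsIntegral.of_mem_of_fg _ hζi.fg_adjoin_singleton _ (aeval_mem_adjoin_singleton _ _)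
    have hgi' : IsIntegral ℤ (conj (aeval ζ g)) :=
      hgi.map (starRingEnd ℂ).toIntAlgHom
    have hnorm : aeval ζ g * conj (aeval ζ g) = algebraMap ℚ ℂ ((n : ℚ) / (q : ℚ) ^ 2) := by
      rw [hg] at hf
      simp only [map_mul, map_natCast] at hf
      simp only [map_div₀, map_pow, map_natCast]
      rw [eq_div_iff (pow_ne_zero 2 hq0), ← hf]
      ring
    have hi := hgi.mul hgi'
    rw [hnorm, isIntegral_algebraMap_iff (algebraMap ℚ ℂ).injective,
      IsIntegrallyClosed.isIntegral_iff] at hi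
    obtain ⟨z, hz⟩ := hi
    have hqQ : (q : ℚ) ≠ 0 := by exact_mod_cast hq.ne_zero
    have hz' : z * (q : ℤ) ^ 2 = n := by
      rw [eq_div_iff (pow_ne_zero 2 hqQ)] at hz
      rw [eq_intCast] at hz
      exact_mod_cast hz
    have hd : q ^ 2 ∣ n := by
      have : ((q ^ 2 : ℕ) : ℤ) ∣ n := ⟨z, by rw [← hz']; push_cast; ring⟩
      exact_mod_cast this
    obtain ⟨d, rfl⟩ := hd
    have hd0 : d ≠ 0 := right_ne_zero_of_mul hn
    have hlt : d < q ^ 2 * d := by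
      exact lt_mul_of_one_lt_left (Nat.pos_of_ne_zero hd0)
        (one_lt_pow₀ hq.one_lt two_ne_zero)
    have hd' : aeval ζ g * conj (aeval ζ g) = d := by
      rw [hnorm]
      rw [Nat.cast_mul, Nat.cast_pow, mul_div_cancel_left₀ _ (pow_ne_zero 2 hqQ), map_natCast]
    rw [padicValNat.mul (pow_ne_zero 2 hq.ne_zero) hd0, padicValNat.prime_pow]
    exact even_two.add (ih d hlt hd0 g hd')

lemma IsPrimitiveRoot.dvd_eval_one_of_aeval_eq_zero {p : ℕ} (hp : p.Prime) {ζ : ℂ}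
    (hζ : IsPrimitiveRoot ζ p) {f : ℤ[X]} (hf : aeval ζ f = 0) : (p : ℤ) ∣ f.eval 1 := by
  have h : cyclotomic p ℤ ∣ f := by
    rw [cyclotomic_eq_minpoly hζ hp.pos]
    exact minpoly.isIntegrallyClosed_dvd (hζ.isIntegral hp.pos) hf
  have := Fact.mk hp
  simpa only [eval_one_cyclotomic_prime] using eval_dvd (x := 1) h

/-- If `conj (x j) * (∑ l, x l - x j)` is a fixed negative real number for all `j` and the sum of
the `x j` is nonzero, then two of the `x j` satisfy an integral linear relation whose coefficients
add up to `m - 2`. -/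
lemma exists_linear_relation {m lam : ℕ} (hl : 0 < lam) (hm : 0 < m) (x : Fin m → ℂ)
    (hS : ∑ l, x l ≠ 0) (h : ∀ j, conj (x j) * (∑ l, x l - x j) = -lam) :
    ∃ (i j : Fin m) (u : ℤ), u * x i + ((m : ℤ) - 2 - u : ℤ) * x j = 0 := by
  classical
  set S := ∑ l, x l with hSdef
  have hN : 0 < Complex.normSq S := Complex.normSq_pos.mpr hS
  set N := Complex.normSq S
  have hSS : S * conj S = N := Complex.mul_conj S
  have hcS : conj S ≠ 0 := by simpa using hS
  have hreal : ∀ j, ∃ a : ℝ, x j = a * S ∧ a ^ 2 - a = lam / N := by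
    intro j
    have hj := h j
    have hS' : S * conj (x j) = Complex.normSq (x j) - lam := by
      rw [← Complex.mul_conj]
      linear_combination hj
    have hN' : (N : ℂ) ≠ 0 := by exact_mod_cast hN.ne'
    have hS'' : conj S * x j = Complex.normSq (x j) - lam := by
      have := congrArg conj hS'
      simpa using this
    refine ⟨(Complex.normSq (x j) - lam) / N, ?_, ?_⟩
    · push_cast
      rw [← hS'', ← hSS]
      field_simp
    · have h1 : (Complex.normSq (x j) - lam) ^ 2 = N * Complex.normSq (x j) := by
        have : ((Complex.normSq (x j) : ℂ) - lam) ^ 2 = N * Complex.normSq (x j) := by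
          calc ((Complex.normSq (x j) : ℂ) - lam) ^ 2
              = (S * conj (x j)) * (conj S * x j) := by rw [hS', hS'', sq]
            _ = N * Complex.normSq (x j) := by
              rw [← hSS, ← Complex.mul_conj (x j)]
              ring
        exact_mod_cast this
      field_simp
      linarith
  choose a hxa ha using hreal
  have hsum : ∑ j, a j = 1 := by
    have : ((∑ j, a j : ℝ) : ℂ) * S = 1 * S := by
      push_cast
      rw [Finset.sum_mul, one_mul, hSdef]
      exact Finset.sum_congr rfl fun j _ => (hxa j).symm
    exact_mod_cast mul_right_cancel₀ hS this
  have hmu : 0 < lam / N := by positivity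
  have hdich : ∀ i j, a j = a i ∨ a j = 1 - a i := by
    intro i j
    have : (a j - a i) * (a j - (1 - a i)) = 0 := by linear_combination ha j - ha i
    rcases mul_eq_zero.mp this with h | h
    · exact Or.inl (by linarith)
    · exact Or.inr (by linarith)
  set i : Fin m := ⟨0, hm⟩
  have hne : ∃ j, a j = 1 - a i := by
    by_contra! hcon
    have hall : ∀ j, a j = a i := fun j => (hdich i j).resolve_right (hcon j)
    have h1 : (m : ℝ) * a i = 1 := by
      rw [← hsum, Finset.sum_congr rfl fun j _ => hall j]
      simp
    have hm1 : (1 : ℝ) ≤ m := by exact_mod_cast hm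
    nlinarith [ha i]
  obtain ⟨j, hj⟩ := hne
  have hai : a i ≠ 1 - a i := by
    intro hc
    nlinarith [ha i]
  have hval : ∀ l, a l = (if a l = a i then 1 else 0) * (a i - (1 - a i)) + (1 - a i) := by
    intro l
    split_ifs with hl
    · rw [hl]; ring
    · rw [(hdich i l).resolve_left hl]; ring
  set r := (Finset.univ.filter fun l => a l = a i).card
  have hr : (r : ℝ) * (a i - (1 - a i)) + m * (1 - a i) = 1 := by
    calc (r : ℝ) * (a i - (1 - a i)) + m * (1 - a i)
        = ∑ l, ((if a l = a i then 1 else 0) * (a i - (1 - a i)) + (1 - a i)) := by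
          rw [Finset.sum_add_distrib, ← Finset.sum_mul, Finset.sum_boole, Finset.sum_const,
            Finset.card_univ, Fintype.card_fin, nsmul_eq_mul]
      _ = 1 := by exact (Finset.sum_congr rfl fun l _ => (hval l).symm).trans hsum
  refine ⟨i, j, (r : ℤ) - 1, ?_⟩
  have hr' : ((r : ℝ) - 1) * a i + (m - 2 - (r - 1)) * a j = 0 := by
    rw [hj]; linear_combination hr
  have hrC : ((r : ℂ) - 1) * a i + (m - 2 - (r - 1)) * a j = 0 := by exact_mod_cast hr'
  rw [hxa i, hxa j]
  push_cast
  linear_combination S * hrC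

lemma IsSEDF.sum_mul_sum {G : Type*} [CommGroup G] [Fintype G] [DecidableEq G] {m k lam : ℕ}
    {D : Fin m → Finset G} (hD : IsSEDF D k lam) (χ : G →* ℂ) (j : Fin m) :
    (∑ y ∈ D j, χ y⁻¹) * (∑ l, ∑ x ∈ D l, χ x - ∑ x ∈ D j, χ x) = lam * (∑ g, χ g - 1) := by
  have hcount := hD.2.2.2.2.2 j
  have hfil : ∑ l, ∑ x ∈ D l, χ x - ∑ x ∈ D j, χ x
      = ∑ l ∈ Finset.univ.filter (fun l => l ≠ j), ∑ x ∈ D l, χ x := by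
    rw [Finset.filter_ne', ← Finset.add_sum_erase _ _ (Finset.mem_univ j), add_sub_cancel_left]
  have hprod : ∀ l, (∑ y ∈ D j, χ y⁻¹) * ∑ x ∈ D l, χ x
      = ∑ g, (((D l ×ˢ D j).filter (fun x => x.1 * x.2⁻¹ = g)).card : ℂ) * χ g := by
    intro l
    rw [mul_comm, Finset.sum_mul_sum, ← Finset.sum_product',
      ← Finset.sum_fiberwise (D l ×ˢ D j) (fun x => x.1 * x.2⁻¹)]
    refine Finset.sum_congr rfl fun g _ => ?_
    rw [← nsmul_eq_mul, ← Finset.sum_const]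
    refine Finset.sum_congr rfl fun x hx => ?_
    rw [← (Finset.mem_filter.mp hx).2, map_mul]
  rw [hfil, Finset.mul_sum, Finset.sum_congr rfl fun l _ => hprod l, Finset.sum_comm]
  have : ∀ g, ∑ l ∈ Finset.univ.filter (fun l => l ≠ j),
      (((D l ×ˢ D j).filter (fun x => x.1 * x.2⁻¹ = g)).card : ℂ) * χ g
      = lam * χ g - if g = 1 then (lam : ℂ) else 0 := by
    intro g
    rw [← Finset.sum_mul, ← Nat.cast_sum, hcount g]
    split_ifs with hg <;> simp [hg]
  rw [Finset.sum_congr rfl fun g _ => this g, Finset.sum_sub_distrib, ← Finset.mul_sum]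
  simp
  ring

lemma IsSEDF.sq_mul_eq {G : Type*} [CommGroup G] [Fintype G] [DecidableEq G] {m k lam : ℕ}
    {D : Fin m → Finset G} (hD : IsSEDF D k lam) :
    k ^ 2 * (m - 1) = lam * (Fintype.card G - 1) := by
  have hm := hD.1
  have h := hD.sum_mul_sum 1 ⟨0, hm⟩
  have hG : 1 ≤ Fintype.card G := Fintype.card_pos
  simp only [MonoidHom.one_apply, Finset.sum_const, hD.2.2.2.1, Finset.card_univ,
    Fintype.card_fin, nsmul_eq_mul, mul_one] at h
  have : ((k ^ 2 * (m - 1) : ℕ) : ℂ) = (lam * (Fintype.card G - 1) : ℕ) := by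
    push_cast [Nat.cast_sub hG, Nat.cast_sub (show 1 ≤ m from hm)]
    linear_combination h
  exact_mod_cast this

/-- A finite abelian group whose order is divisible by a prime `p` has a complex character
whose values are the powers of a primitive `p`-th root of unity. -/
lemma exists_monoidHom_pow_primitiveRoot (G : Type*) [CommGroup G] [Fintype G] {p : ℕ}
    (hp : p.Prime) (hdvd : p ∣ Fintype.card G) :
    ∃ (χ : G →* ℂ) (ζ : ℂ) (e : G → ℕ), IsPrimitiveRoot ζ p ∧ χ ≠ 1 ∧ ∀ g, χ g = ζ ^ e g := by
  have := Fact.mk hp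
  have : NeZero p := ⟨hp.ne_zero⟩
  obtain ⟨E⟩ := CommGroup.monoidHom_mulEquiv_of_hasEnoughRootsOfUnity G ℂ
  obtain ⟨g, hg⟩ := exists_prime_orderOf_dvd_card p hdvd
  have hφ : orderOf (E.symm g) = p := by rw [MulEquiv.orderOf_eq, hg]
  set φ := E.symm g
  refine ⟨(Units.coeHom ℂ).comp φ, Complex.exp (2 * Real.pi * Complex.I / p), ?_⟩
  have hζ := Complex.isPrimitiveRoot_exp p hp.ne_zero
  have hpow : ∀ g, ((φ g : ℂˣ) : ℂ) ^ p = 1 := by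
    intro g
    have := DFunLike.congr_fun (pow_orderOf_eq_one φ) g
    rw [hφ] at this
    rw [← Units.val_pow_eq_pow_val, ← MonoidHom.pow_apply, this]
    simp
  choose e _ he using fun g => hζ.eq_pow_of_pow_eq_one (hpow g)
  refine ⟨e, hζ, ?_, fun g => (he g).symm⟩
  intro h1
  have : φ = 1 := by
    ext g
    simpa using DFunLike.congr_fun h1 g
  rw [this, orderOf_one] at hφ
  exact hp.one_lt.ne hφ

/-- Let `m, b, c` be positive integers with `m > 2`, let `q` be a prime such that
`q^{2c} ∥ m-1` or `q ∤ m-1`, and let `p` be an odd prime with `p ∣ q^{2b+1}+1`.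
If `p ∤ (m-2)k`, then no `(q^{2b+1}+1, m, k, λ)`-SEDF exists in any finite abelian
group. -/
theorem sedf_nonexistence_odd_power
    (m b c : ℕ) (hm : 2 < m) (hb : 0 < b) (hc : 0 < c)
    (q : ℕ) (hq : q.Prime)
    (hqm : (q ^ (2 * c) ∣ m - 1 ∧ ¬ q ^ (2 * c + 1) ∣ m - 1) ∨ ¬ q ∣ m - 1)
    (p : ℕ) (hp : p.Prime) (hodd : Odd p)
    (hdvd : p ∣ q ^ (2 * b + 1) + 1)
    (k lam : ℕ) (hk : ¬ p ∣ (m - 2) * k) :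
    ∀ (G : Type) [CommGroup G] [Fintype G] [DecidableEq G] (D : Fin m → Finset G),
      Fintype.card G = q ^ (2 * b + 1) + 1 → ¬ IsSEDF D k lam := by
  intro G _ _ _ D hG hD
  have := Fact.mk hq
  have hk0 : k ≠ 0 := hD.2.1.ne'
  have hl0 : lam ≠ 0 := hD.2.2.1.ne'
  obtain ⟨χ, ζ, e, hζ, hχ, he⟩ := exists_monoidHom_pow_primitiveRoot G hp (hG ▸ hdvd)
  have hconj : ∀ g, χ g⁻¹ = conj (χ g) := by
    intro g
    have h1 : ‖χ g‖ = 1 := by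
      rw [he, norm_pow, Complex.norm_eq_one_of_pow_eq_one hζ.pow_eq_one hp.ne_zero, one_pow]
    rw [← Complex.inv_eq_conj h1]
    apply eq_inv_of_mul_eq_one_left
    rw [← map_mul, inv_mul_cancel, map_one]
  have hsum : ∑ g, χ g = 0 := by
    obtain ⟨a, ha⟩ : ∃ a, χ a ≠ 1 := by
      by_contra! h
      exact hχ (MonoidHom.ext h)
    have h1 : χ a * ∑ g, χ g = ∑ g, χ g := by
      rw [Finset.mul_sum, ← Equiv.sum_comp (Equiv.mulLeft a) (fun g => χ g)]
      simp
    have h2 : (χ a - 1) * ∑ g, χ g = 0 := by linear_combination h1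
    exact (mul_eq_zero.mp h2).resolve_left (sub_ne_zero.mpr ha)
  set f : Fin m → ℤ[X] := fun j => ∑ g ∈ D j, X ^ e g
  have hf : ∀ j, aeval ζ (f j) = ∑ g ∈ D j, χ g := by
    intro j
    simp [f, he]
  have hf1 : ∀ j, (f j).eval 1 = k := by
    intro j
    simp [f, eval_finsetSum, hD.2.2.2.1 j]
  have hmain : ∀ j, conj (aeval ζ (f j)) * (∑ l, aeval ζ (f l) - aeval ζ (f j)) = -lam := by
    intro j
    have := hD.sum_mul_sum χ j
    simp only [hf, map_sum, ← hconj]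
    rw [this, hsum]
    ring
  by_cases hS : ∑ l, aeval ζ (f l) = 0
  · have hnorm : aeval ζ (f ⟨0, by omega⟩) * conj (aeval ζ (f ⟨0, by omega⟩)) = lam := by
      have := hmain ⟨0, by omega⟩
      rw [hS] at this
      linear_combination -this
    have heven := even_padicValNat_of_norm (by omega) hdvd hζ.pow_eq_one hp.ne_zero lam hl0 _ hnorm
    have hcount := hD.sq_mul_eq
    have hm1 : m - 1 ≠ 0 := by omega
    rw [hG, Nat.add_sub_cancel] at hcount
    have hval := congrArg (padicValNat q) hcount
    rw [padicValNat.mul (pow_ne_zero 2 hk0) hm1, padicValNat.mul hl0 (pow_ne_zero _ hq.ne_zero),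
      padicValNat.prime_pow, padicValNat.pow] at hval
    have hev : Even (padicValNat q (m - 1)) := by
      rcases hqm with ⟨h1, h2⟩ | h
      · rw [padicValNat_dvd_iff_le hm1] at h1 h2
        exact ⟨c, by omega⟩
      · simp [padicValNat.eq_zero_of_not_dvd h]
    obtain ⟨s, hs⟩ := heven
    obtain ⟨t, ht⟩ := hev
    omega
  · obtain ⟨i, j, u, hu⟩ :=
      exists_linear_relation hD.2.2.1 hD.1 (fun l => aeval ζ (f l)) hS hmain
    have hz : aeval ζ (C u * f i + C ((m : ℤ) - 2 - u) * f j) = 0 := by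
      rw [map_add, map_mul, map_mul, aeval_C, aeval_C]
      simpa using hu
    have hd := hζ.dvd_eval_one_of_aeval_eq_zero hp hz
    simp only [eval_add, eval_mul, eval_C, hf1] at hd
    apply hk
    have : (p : ℤ) ∣ ((m - 2) * k : ℕ) := by
      push_cast [Nat.cast_sub hm.le]
      convert hd using 1
      ring
    exact_mod_cast this
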